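/- (Symmetric Mountain Pass Theorem) Let V be an infinite-dimensional real Banach space and let E : V → ℝ be a C¹ functional satisfying the Palais–Smale condition, with E(u) = E(-u) for all u ∈ V and E(0) = 0. Suppose V = V⁻ ⊕ V⁺, where V⁻ is a finite-dimensional subspace, and: (1) there exist α > 0 and ρ > 0 such that E(u) ≥ α for every u ∈ V⁺ with ‖u‖_V = ρ; (2) for every finite-dimensional subspace W ⊂ V there is a constant R = R(W) > 0 such that E(u) ≤ 0 for all u ∈ W with ‖u‖_V ≥ R. Then E possesses an unbounded sequence of critical values: there exist u_k ∈ V with DE(u_k) = 0 and E(u_k) → +∞ as k → ∞. -/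

import Mathlib

open Filter Bornology


namespace SMP

/-! ### Mod 2 chains of lists -/

abbrev Ch (X : Type*) := List X →₀ ZMod 2

noncomputable section

def tup {X : Type*} (l : List X) : Ch X := Finsupp.single l 1

def lext {X M : Type*} [AddCommGroup M] [Module (ZMod 2) M] (f : List X → M) :
    Ch X →ₗ[ZMod 2] M := Finsupp.linearCombination (ZMod 2) f

@[simp] lemma lext_tup {X M : Type*} [AddCommGroup M] [Module (ZMod 2) M] (f : List X → M)
    (l : List X) : lext f (tup l) = f l := by
  simp [lext, tup]

lemma hom_ext {X M : Type*} [AddCommGroup M] [Module (ZMod 2) M] {f g : Ch X →ₗ[ZMod 2] M}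
    (h : ∀ l, f (tup l) = g (tup l)) : f = g := by
  apply Finsupp.lhom_ext'
  intro l
  ext
  exact h l

def Sup {X : Type*} (S : Set (List X)) : Submodule (ZMod 2) (Ch X) :=
  Finsupp.supported (ZMod 2) (ZMod 2) S

lemma Sup_eq {X : Type*} (S : Set (List X)) : Sup S = Submodule.span (ZMod 2) (tup '' S) :=
  Finsupp.supported_eq_span_single _ S

lemma tup_mem {X : Type*} {S : Set (List X)} {l : List X} (h : l ∈ S) : tup l ∈ Sup S := by
  rw [Sup_eq]; exact Submodule.subset_span ⟨l, h, rfl⟩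

lemma Sup_mono {X : Type*} {S T : Set (List X)} (h : S ⊆ T) {c : Ch X} (hc : c ∈ Sup S) :
    c ∈ Sup T := Finsupp.supported_mono h hc

lemma Sup_induction {X : Type*} {S : Set (List X)} {p : Ch X → Prop} (h0 : p 0)
    (hadd : ∀ a b, p a → p b → p (a + b)) (ht : ∀ l ∈ S, p (tup l)) {c : Ch X} (hc : c ∈ Sup S) :
    p c := by
  rw [Sup_eq] at hc
  induction hc using Submodule.span_induction with
  | mem x h => obtain ⟨l, hl, rfl⟩ := h; exact ht l hl
  | zero => exact h0
  | add x y _ _ hx hy => exact hadd x y hx hy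
  | smul a x _ hx =>
    have ha : a = 0 ∨ a = 1 := by revert a; decide
    rcases ha with rfl | rfl
    · rw [zero_smul]; exact h0
    · rw [one_smul]; exact hx

lemma map_mem {X Y : Type*} {S : Set (List X)} {T : Set (List Y)} {f : Ch X →ₗ[ZMod 2] Ch Y}
    (h : ∀ l ∈ S, f (tup l) ∈ Sup T) {c : Ch X} (hc : c ∈ Sup S) : f c ∈ Sup T := by
  refine Sup_induction (p := fun c => f c ∈ Sup T) (by simp) ?_ h hc
  intro a b ha hb
  rw [map_add]; exact add_mem ha hb

lemma map_eq {X M : Type*} [AddCommGroup M] [Module (ZMod 2) M] {S : Set (List X)}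
    {f g : Ch X →ₗ[ZMod 2] M}
    (h : ∀ l ∈ S, f (tup l) = g (tup l)) {c : Ch X} (hc : c ∈ Sup S) : f c = g c := by
  refine Sup_induction (p := fun c => f c = g c) (by simp) ?_ h hc
  intro a b ha hb
  simp [ha, hb]

lemma exists_of_ne {X : Type*} {S : Set (List X)} {f : Ch X →ₗ[ZMod 2] ZMod 2} {c : Ch X}
    (hc : c ∈ Sup S) (h : f c ≠ 0) : ∃ l ∈ S, f (tup l) ≠ 0 := by
  by_contra hh
  push Not at hh
  exact h (map_eq (g := 0) (by simpa using hh) hc)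

lemma two_cancel {M : Type*} [AddCommGroup M] [Module (ZMod 2) M] (a : M) : a + a = 0 := by
  have : (2 : ZMod 2) • a = 0 := by
    have : (2 : ZMod 2) = 0 := rfl
    rw [this, zero_smul]
  rwa [two_smul] at this

def cone {X : Type*} (x : X) : Ch X →ₗ[ZMod 2] Ch X := lext fun l => tup (x :: l)

def bdL {X : Type*} : List X → Ch X
  | [] => 0
  | x :: l => tup l + cone x (bdL l)

def bd {X : Type*} : Ch X →ₗ[ZMod 2] Ch X := lext bdL

def nu {X : Type*} [Neg X] : Ch X →ₗ[ZMod 2] Ch X := lext fun l => tup (l.map Neg.neg)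

@[simp] lemma cone_tup {X : Type*} (x : X) (l : List X) : cone x (tup l) = tup (x :: l) := by
  simp [cone]

@[simp] lemma bd_tup {X : Type*} (l : List X) : bd (tup l) = bdL l := by
  simp [bd]

@[simp] lemma nu_tup {X : Type*} [Neg X] (l : List X) :
    nu (tup l) = tup (l.map Neg.neg) := by
  simp [nu]

lemma bd_cone {X : Type*} (x : X) (c : Ch X) : bd (cone x c) = c + cone x (bd c) := by
  have : bd ∘ₗ cone x = LinearMap.id + cone x ∘ₗ bd := by
    apply hom_ext; intro l; simp [bdL]
  exact LinearMap.congr_fun this c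

lemma bd_bdL {X : Type*} (l : List X) : bd (bdL l) = 0 := by
  induction l with
  | nil => simp [bdL]
  | cons x l ih => simp [bdL, bd_cone, ih, two_cancel]

lemma bd_bd {X : Type*} (c : Ch X) : bd (bd c) = 0 := by
  have : (bd ∘ₗ bd : Ch X →ₗ[ZMod 2] Ch X) = 0 := by
    apply hom_ext; intro l; simp [bd_bdL]
  exact LinearMap.congr_fun this c

lemma nu_cone {X : Type*} [Neg X] (x : X) (c : Ch X) : nu (cone x c) = cone (-x) (nu c) := by
  have : nu ∘ₗ cone x = cone (-x) ∘ₗ nu := by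
    apply hom_ext; intro l; simp
  exact LinearMap.congr_fun this c

lemma bdL_neg {X : Type*} [Neg X] (l : List X) : bdL (l.map Neg.neg) = nu (bdL l) := by
  induction l with
  | nil => simp [bdL]
  | cons x l ih => simp [bdL, nu_cone, ih]

lemma bd_nu {X : Type*} [Neg X] (c : Ch X) : bd (nu c) = nu (bd c) := by
  have : (bd ∘ₗ nu : Ch X →ₗ[ZMod 2] Ch X) = nu ∘ₗ bd := by
    apply hom_ext; intro l; simp [bdL_neg]
  exact LinearMap.congr_fun this c

lemma nu_nu {X : Type*} [InvolutiveNeg X] (c : Ch X) : nu (nu c) = c := by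
  have : (nu ∘ₗ nu : Ch X →ₗ[ZMod 2] Ch X) = LinearMap.id := by
    apply hom_ext; intro l; simp
  exact LinearMap.congr_fun this c

lemma bdL_mem {X : Type*} (l : List X) :
    bdL l ∈ Sup {l' : List X | l' ⊆ l ∧ l'.length + 1 = l.length} := by
  induction l with
  | nil => simp [bdL]
  | cons x l ih =>
    simp only [bdL]
    refine add_mem (tup_mem ⟨by simp, by simp⟩) (map_mem ?_ ih)
    rintro l' ⟨h1, h2⟩
    rw [cone_tup]
    exact tup_mem ⟨List.cons_subset_cons x h1, by simp; omega⟩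

/-! ### Cochains -/

def cc {X : Type*} : List (X → ZMod 2) → List X → ZMod 2
  | [], [_] => 1
  | e :: es, x :: y :: l => (e x + e y) * cc es (y :: l)
  | _, _ => 0

def bb {X : Type*} (f : X → ZMod 2) (es : List (X → ZMod 2)) : List X → ZMod 2
  | [] => 0
  | x :: l => f x * cc es (x :: l)

lemma cc_nil {X : Type*} (es : List (X → ZMod 2)) : cc es [] = 0 := by
  cases es <;> rfl

lemma bb_cone {X : Type*} (f : X → ZMod 2) (es : List (X → ZMod 2)) (x : X) (c : Ch X) :
    lext (bb f es) (cone x c) = f x * lext (cc es) (cone x c) := by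
  have : lext (bb f es) ∘ₗ cone x = f x • (lext (cc es) ∘ₗ cone x) := by
    apply hom_ext; intro l; simp [bb]
  exact LinearMap.congr_fun this c

lemma bb_bd_aux {X : Type*} (es : List (X → ZMod 2))
    (h : ∀ l : List X, lext (cc es) (bdL l) = 0) (f : X → ZMod 2) (l : List X) :
    lext (bb f es) (bdL l) = cc (f :: es) l := by
  rcases l with _ | ⟨x, l⟩
  · simp [bdL, cc]
  · have h1 := h (x :: l)
    simp only [bdL, map_add, lext_tup] at h1 ⊢
    rw [bb_cone]
    have h2 : lext (cc es) (cone x (bdL l)) = cc es l := by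
      have := two_cancel (cc es l)
      exact add_left_cancel (h1.trans this.symm)
    rw [h2]
    rcases l with _ | ⟨y, l⟩
    · simp [bb, cc, cc_nil]
    · simp only [bb, cc]; ring

lemma cc_bdL {X : Type*} (es : List (X → ZMod 2)) (l : List X) :
    lext (cc es) (bdL l) = 0 := by
  induction es generalizing l with
  | nil =>
    rcases l with _ | ⟨x, _ | ⟨y, _ | ⟨z, l⟩⟩⟩
    · simp [bdL]
    · simp [bdL, cc]
    · simp [bdL, cc]; rfl
    · have := map_eq (f := lext (cc [])) (g := 0) ?_ (bdL_mem (x :: y :: z :: l))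
      · exact this
      · rintro l' ⟨-, h⟩
        rcases l' with _ | ⟨a, _ | ⟨b, l'⟩⟩
        · simp [cc]
        · simp at h
        · simp [cc]
  | cons e es ih =>
    have h : lext (cc (e :: es)) = lext (bb e es) ∘ₗ bd := by
      apply hom_ext; intro l
      simp [bb_bd_aux es ih]
    rw [h]
    simp [bd_bdL]

lemma bb_bd {X : Type*} (f : X → ZMod 2) (es : List (X → ZMod 2)) (c : Ch X) :
    lext (bb f es) (bd c) = lext (cc (f :: es)) c := by
  have : lext (bb f es) ∘ₗ bd = lext (cc (f :: es)) := by
    apply hom_ext; intro l; simp [bb_bd_aux es (cc_bdL es)]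
  exact LinearMap.congr_fun this c

/-- antisymmetric away from zero -/
def Anti {X : Type*} [AddGroup X] (e : X → ZMod 2) : Prop := ∀ x, x ≠ 0 → e (-x) = e x + 1

lemma cc_neg {X : Type*} [AddGroup X] (es : List (X → ZMod 2)) (hes : ∀ e ∈ es, Anti e)
    (l : List X) (hl : ∀ x ∈ l, x ≠ 0) : cc es (l.map Neg.neg) = cc es l := by
  induction es generalizing l with
  | nil =>
    rcases l with _ | ⟨x, _ | ⟨y, l⟩⟩ <;> simp [cc]
  | cons e es ih =>
    rcases l with _ | ⟨x, _ | ⟨y, l⟩⟩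
    · simp
    · simp [cc]
    · have := ih (fun e he => hes e (by simp [he])) (y :: l) (fun z hz => hl z (by simp at hz ⊢; tauto))
      simp only [List.map_cons] at this ⊢
      simp only [cc]
      rw [this, hes e (by simp) x (hl x (by simp)), hes e (by simp) y (hl y (by simp))]
      have h2 : (2 : ZMod 2) = 0 := rfl
      linear_combination (cc es (y :: l)) * h2

/-- Main evaluation -/
lemma cc_eval {X : Type*} [AddGroup X] (H : ℕ → Ch X) (x0 : X) (h0 : H 0 = tup [x0])
    (es : List (X → ZMod 2)) (hes : ∀ e ∈ es, Anti e)
    (hH : ∀ i < es.length, bd (H (i + 1)) = H i + nu (H i))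
    (hz : ∀ i ≤ es.length, H i ∈ Sup {l : List X | ∀ x ∈ l, x ≠ 0}) :
    lext (cc es) (H es.length) = 1 := by
  induction es with
  | nil => simp [h0, cc]
  | cons e es ih =>
    have := ih (fun e he => hes e (by simp [he])) (fun i hi => hH i (by simp; omega))
      (fun i hi => hz i (by simp; omega))
    rw [List.length_cons, ← bb_bd, hH _ (by simp), map_add, ← this]
    have : lext (cc es) (H es.length) =
      (lext (bb e es) + lext (bb e es) ∘ₗ nu) (H es.length) := by
      refine map_eq ?_ (hz es.length (by simp))
      intro l hl
      rcases l with _ | ⟨x, l⟩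
      · simp [bb, cc_nil]
      · have h1 := cc_neg es (fun e he => hes e (by simp [he])) (x :: l) hl
        simp only [List.map_cons] at h1
        simp only [LinearMap.add_apply, LinearMap.comp_apply, nu_tup, lext_tup, List.map_cons, bb]
        rw [h1, hes e (by simp) x (hl x (by simp))]
        have h2 : (2 : ZMod 2) = 0 := rfl
        linear_combination (-e x * cc es (x :: l)) * h2
    rw [this]; rfl

end

end SMP

namespace SMP
noncomputable section

set_option linter.unusedSectionVars false

variable {X : Type*} [NormedAddCommGroup X] [NormedSpace ℝ X]

def bary (l : List X) : X := (l.length : ℝ)⁻¹ • l.sum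

lemma bary_neg (l : List X) : bary (l.map Neg.neg) = -bary l := by
  have : (l.map Neg.neg).sum = -l.sum := by
    induction l with
    | nil => simp
    | cons x l ih => simp [ih, add_comm]
  simp [bary, this]

lemma bary_single (x : X) : bary [x] = x := by simp [bary]

lemma bary_mem {S : Set X} (hS : Convex ℝ S) (l : List X) (hl : l ≠ []) (h : ∀ x ∈ l, x ∈ S) :
    bary l ∈ S := by
  induction l with
  | nil => exact absurd rfl hl
  | cons x l ih =>
    by_cases hl' : l = []
    · subst hl'; rw [bary_single]; exact h x (by simp)
    · have h1 := ih hl' (fun y hy => h y (by simp [hy]))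
      have hn : (0 : ℝ) < l.length := by
        exact_mod_cast List.length_pos_iff.2 hl'
      have h2 := hS (h x (by simp)) h1 (a := ((l.length : ℝ) + 1)⁻¹)
        (b := (l.length : ℝ) * ((l.length : ℝ) + 1)⁻¹) (by positivity) (by positivity)
        (by field_simp; ring)
      convert h2 using 1
      simp only [bary, List.length_cons, List.sum_cons, smul_add, smul_smul]
      congr 2
      · push_cast; rfl
      · push_cast; field_simp

lemma bary_dist (l : List X) (d : ℝ) (v : X) (hv : v ∈ l) (h : ∀ x ∈ l, dist x v ≤ d) :
    dist v (bary l) ≤ (1 - (l.length : ℝ)⁻¹) * d := by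
  have key : ∀ l : List X, (∀ x ∈ l, dist x v ≤ d) → ‖(l.map (fun x => x - v)).sum‖ ≤ l.length * d := by
    intro l h
    induction l with
    | nil => simp
    | cons x l ih =>
      have h1 := ih (fun y hy => h y (by simp [hy]))
      have h2 := h x (by simp)
      rw [dist_eq_norm] at h2
      simp only [List.map_cons, List.sum_cons, List.length_cons]
      push_cast
      have := norm_add_le (x - v) (l.map (fun x => x - v)).sum
      linarith
  obtain ⟨s, t, rfl⟩ := List.append_of_mem hv
  have hs := key s (fun x hx => h x (by simp [hx]))
  have ht := key t (fun x hx => h x (by simp [hx]))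
  have hsum : ∀ l : List X, (l.map (fun x => x - v)).sum = l.sum - (l.length : ℝ) • v := by
    intro l
    induction l with
    | nil => simp
    | cons x l ih => simp only [List.map_cons, List.sum_cons, ih, List.length_cons]; push_cast; module
  have hn : (0 : ℝ) < s.length + t.length + 1 := by positivity
  have e : bary (s ++ v :: t) - v = ((s.length : ℝ) + t.length + 1)⁻¹ •
      ((s.map (fun x => x - v)).sum + (t.map (fun x => x - v)).sum) := by
    rw [hsum, hsum]
    have hv' : ((s.length : ℝ) + t.length + 1)⁻¹ • (((s.length : ℝ) + t.length + 1) • v) = v := by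
      rw [smul_smul, inv_mul_cancel₀ hn.ne', one_smul]
    simp only [bary, List.length_append, List.length_cons, List.sum_append, List.sum_cons]
    push_cast
    rw [← add_assoc]
    refine (congrArg (fun z => _ - z) hv'.symm).trans ?_
    rw [← smul_sub]
    congr 1
    module
  rw [dist_comm, dist_eq_norm, e, norm_smul, Real.norm_of_nonneg (by positivity)]
  calc _ ≤ ((s.length : ℝ) + t.length + 1)⁻¹ * (s.length * d + t.length * d) := by
        gcongr
        exact (norm_add_le _ _).trans (add_le_add hs ht)
    _ = _ := by
        simp only [List.length_append, List.length_cons]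
        push_cast
        field_simp
        ring

/-- barycentric subdivision of lists of length `k` -/
def Sd : ℕ → Ch X →ₗ[ZMod 2] Ch X
  | 0 => LinearMap.id
  | k + 1 => lext fun l => cone (bary l) (Sd k (bdL l))

lemma Sd_succ_tup (k : ℕ) (l : List X) : Sd (k + 1) (tup l) = cone (bary l) (Sd k (bdL l)) := by
  rw [Sd]; simp

lemma Sd_zero (c : Ch X) : Sd 0 c = c := rfl

attribute [irreducible] Sd

lemma Sd_nu (k : ℕ) (c : Ch X) : Sd k (nu c) = nu (Sd k c) := by
  induction k generalizing c with
  | zero => simp [Sd_zero]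
  | succ k ih =>
    have : (Sd (k + 1) ∘ₗ nu : Ch X →ₗ[ZMod 2] Ch X) = nu ∘ₗ Sd (k + 1) := by
      apply hom_ext; intro l; simp [Sd_succ_tup, nu_cone, bary_neg, bdL_neg, ih]
    exact LinearMap.congr_fun this c

def Len (X : Type*) (k : ℕ) : Submodule (ZMod 2) (Ch X) := Sup {l : List X | l.length = k}

lemma bd_Len {k : ℕ} {c : Ch X} (hc : c ∈ Len X (k + 1)) : bd c ∈ Len X k := by
  refine map_mem ?_ hc
  intro l hl
  rw [bd_tup]
  refine Sup_mono ?_ (bdL_mem l)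
  rintro l' ⟨-, h⟩
  simp at hl ⊢; omega

lemma cone_Len {k : ℕ} {c : Ch X} (x : X) (hc : c ∈ Len X k) : cone x c ∈ Len X (k + 1) := by
  refine map_mem ?_ hc
  intro l hl
  rw [cone_tup]
  exact tup_mem (by simpa using hl)

lemma nu_Len {k : ℕ} {c : Ch X} (hc : c ∈ Len X k) : nu c ∈ Len X k := by
  refine map_mem ?_ hc
  intro l hl
  rw [nu_tup]
  exact tup_mem (by simpa using hl)

lemma bd_Sd (k : ℕ) {c : Ch X} (hc : c ∈ Len X (k + 1)) : bd (Sd (k + 1) c) = Sd k (bd c) := by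
  induction k generalizing c with
  | zero =>
    rw [← LinearMap.comp_apply, ← LinearMap.comp_apply]
    refine map_eq ?_ hc
    intro l hl
    obtain ⟨x, rfl⟩ := List.length_eq_one_iff.1 hl
    simp [Sd_succ_tup, Sd_zero, bdL]
  | succ k ih =>
    rw [← LinearMap.comp_apply, ← LinearMap.comp_apply]
    refine map_eq ?_ hc
    intro l hl
    have h1 : bdL l ∈ Len X (k + 1) := by
      rw [← bd_tup]; exact bd_Len (tup_mem hl)
    have h2 : bd (Sd (k + 1) (bdL l)) = 0 := by
      rw [ih h1, bd_bdL]; simp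
    have h3 := Sd_succ_tup (k + 1) l
    simp only [LinearMap.comp_apply, h3, bd_cone, h2, bd_tup]
    simp

lemma Sd_pres (k : ℕ) (S : Set X) (hS : Convex ℝ S) {c : Ch X}
    (hc : c ∈ Sup {l : List X | l.length = k ∧ ∀ x ∈ l, x ∈ S}) :
    Sd k c ∈ Sup {l : List X | l.length = k ∧ ∀ x ∈ l, x ∈ S} := by
  induction k generalizing c with
  | zero => rw [Sd_zero]; exact hc
  | succ k ih =>
    refine map_mem ?_ hc
    rintro l ⟨hl, hlS⟩
    have h1 : bdL l ∈ Sup {l : List X | l.length = k ∧ ∀ x ∈ l, x ∈ S} := by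
      refine Sup_mono ?_ (bdL_mem l)
      rintro l' ⟨h1, h2⟩
      exact ⟨by omega, fun x hx => hlS x (h1 hx)⟩
    have h3 := Sd_succ_tup k l
    rw [h3]
    refine map_mem ?_ (ih h1)
    rintro l' ⟨h1, h2⟩
    rw [cone_tup]
    have hb := bary_mem hS l (by rintro rfl; simp at hl) hlS
    exact tup_mem ⟨by simp [h1], by simpa using ⟨hb, h2⟩⟩

lemma Sd_small (k N : ℕ) (hk : k ≤ N) (d : ℝ) (hd : 0 ≤ d) {c : Ch X}
    (hc : c ∈ Sup {l : List X | l.length = k ∧ ∀ x ∈ l, ∀ y ∈ l, dist x y ≤ d}) :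
    Sd k c ∈ Sup {l : List X | l.length = k ∧ ∀ x ∈ l, ∀ y ∈ l,
      dist x y ≤ (1 - (N : ℝ)⁻¹) * d} := by
  induction k generalizing c with
  | zero =>
    rw [Sd_zero]
    refine Sup_mono ?_ hc
    rintro l ⟨h1, h2⟩
    obtain rfl := List.length_eq_zero_iff.1 h1
    simp
  | succ k ih =>
    refine map_mem ?_ hc
    rintro l ⟨hl, hld⟩
    have h3 := Sd_succ_tup k l
    have hN : (0 : ℝ) < N := by
      have : 0 < N := by omega
      exact_mod_cast this
    have hr : (0 : ℝ) ≤ (1 - (N : ℝ)⁻¹) * d := by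
      apply mul_nonneg _ hd
      rw [sub_nonneg]
      apply inv_le_one_of_one_le₀
      have : 1 ≤ N := by omega
      exact_mod_cast this
    have h1 : bdL l ∈ Sup {l : List X | l.length = k ∧ ∀ x ∈ l, ∀ y ∈ l, dist x y ≤ d} := by
      refine Sup_mono ?_ (bdL_mem l)
      rintro l' ⟨h1, h2⟩
      exact ⟨by omega, fun x hx y hy => hld x (h1 hx) y (h1 hy)⟩
    set S := Metric.closedBall (bary l) ((1 - (N : ℝ)⁻¹) * d) with hS
    have hlS : ∀ x ∈ l, x ∈ S := by
      intro x hx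
      rw [hS, Metric.mem_closedBall]
      refine (bary_dist l d x hx (fun y hy => hld y hy x hx)).trans ?_
      gcongr
      · rw [hl]; positivity
      · rw [hl]; exact_mod_cast hk
    have h4 : bdL l ∈ Sup {l : List X | l.length = k ∧ ∀ x ∈ l, x ∈ S} := by
      refine Sup_mono ?_ (bdL_mem l)
      rintro l' ⟨h1, h2⟩
      exact ⟨by omega, fun x hx => hlS x (h1 hx)⟩
    have h5 := ih (by omega) h1
    have h6 := Sd_pres k S (convex_closedBall _ _) h4
    have h7 : Sd k (bdL l) ∈ Sup ({l : List X | l.length = k ∧ ∀ x ∈ l, ∀ y ∈ l,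
      dist x y ≤ (1 - (N : ℝ)⁻¹) * d} ∩ {l : List X | l.length = k ∧ ∀ x ∈ l, x ∈ S}) := by
      unfold Sup
      rw [Finsupp.supported_inter]
      exact ⟨h5, h6⟩
    rw [h3]
    refine map_mem ?_ h7
    rintro l' ⟨⟨h1, h2⟩, -, h3⟩
    rw [cone_tup]
    refine tup_mem ⟨by simp [h1], ?_⟩
    intro x hx y hy
    rcases List.mem_cons.1 hx with rfl | hx <;> rcases List.mem_cons.1 hy with rfl | hy
    · simpa using hr
    · rw [dist_comm]; exact h3 y hy
    · exact h3 x hx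
    · exact h2 x hx y hy

/-- iterates -/
def SdI (k j : ℕ) (c : Ch X) : Ch X := (Sd k)^[j] c

lemma SdI_succ (k j : ℕ) (c : Ch X) : SdI k (j + 1) c = Sd k (SdI k j c) :=
  Function.iterate_succ_apply' _ _ _

lemma SdI_add (k j : ℕ) (a b : Ch X) : SdI k j (a + b) = SdI k j a + SdI k j b := by
  induction j with
  | zero => rfl
  | succ j ih => simp [SdI_succ, ih]

lemma SdI_nu (k j : ℕ) (a : Ch X) : SdI k j (nu a) = nu (SdI k j a) := by
  induction j with
  | zero => rfl
  | succ j ih => simp [SdI_succ, ih, Sd_nu]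

lemma SdI_pres (k j : ℕ) (S : Set X) (hS : Convex ℝ S) {c : Ch X}
    (hc : c ∈ Sup {l : List X | l.length = k ∧ ∀ x ∈ l, x ∈ S}) :
    SdI k j c ∈ Sup {l : List X | l.length = k ∧ ∀ x ∈ l, x ∈ S} := by
  induction j with
  | zero => exact hc
  | succ j ih => rw [SdI_succ]; exact Sd_pres k S hS ih

lemma SdI_Len (k j : ℕ) {c : Ch X} (hc : c ∈ Len X k) : SdI k j c ∈ Len X k := by
  have := SdI_pres k j Set.univ convex_univ (c := c) (Sup_mono (by simp) hc)
  exact Sup_mono (by simp) this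

lemma SdI_small (k j N : ℕ) (hk : k ≤ N) (hk1 : 1 ≤ N) (d : ℝ) (hd : 0 ≤ d) {c : Ch X}
    (hc : c ∈ Sup {l : List X | l.length = k ∧ ∀ x ∈ l, ∀ y ∈ l, dist x y ≤ d}) :
    SdI k j c ∈ Sup {l : List X | l.length = k ∧ ∀ x ∈ l, ∀ y ∈ l,
      dist x y ≤ (1 - (N : ℝ)⁻¹) ^ j * d} := by
  have h0 : (0 : ℝ) ≤ 1 - (N : ℝ)⁻¹ := by
    rw [sub_nonneg]
    apply inv_le_one_of_one_le₀
    exact_mod_cast hk1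
  induction j with
  | zero => simpa [SdI] using hc
  | succ j ih =>
    rw [SdI_succ]
    have := Sd_small k N hk _ (by positivity) ih
    rw [pow_succ', mul_assoc]
    exact this

lemma bd_SdI (k j : ℕ) {c : Ch X} (hc : c ∈ Len X (k + 1)) :
    bd (SdI (k + 1) j c) = SdI k j (bd c) := by
  induction j with
  | zero => rfl
  | succ j ih => rw [SdI_succ, bd_Sd k (SdI_Len _ _ hc), ih, SdI_succ]

lemma SdI_single (x : X) (j : ℕ) : SdI 1 j (tup [x]) = tup [x] := by
  induction j with
  | zero => rfl
  | succ j ih => rw [SdI_succ, ih]; simp [Sd_succ_tup, Sd_zero, bdL, bary_single]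

end
end SMP

namespace SMP
noncomputable section

def ev (n i : ℕ) : Fin n → ℝ := fun j => if j.val = i then 1 else 0

def hh (n : ℕ) : ℕ → Ch (Fin n → ℝ)
  | 0 => tup [ev n 0]
  | i + 1 => cone (ev n (i + 1)) (hh n i + nu (hh n i))

lemma bd_hh_aux (n i : ℕ) : bd (hh n i + nu (hh n i)) = 0 ∧
    bd (hh n (i + 1)) = hh n i + nu (hh n i) := by
  induction i with
  | zero =>
    have h1 : bd (hh n 0 + nu (hh n 0)) = 0 := by
      simp [hh, bdL, two_cancel]
    refine ⟨h1, ?_⟩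
    rw [show hh n (0 + 1) = cone _ (hh n 0 + nu (hh n 0)) from rfl, bd_cone, h1]; simp
  | succ i ih =>
    have h1 : bd (hh n (i + 1) + nu (hh n (i + 1))) = 0 := by
      rw [map_add, bd_nu, ih.2, map_add, nu_nu, add_comm (nu _), two_cancel]
    refine ⟨h1, ?_⟩
    rw [show hh n (i + 1 + 1) = cone _ (hh n (i + 1) + nu (hh n (i + 1))) from rfl, bd_cone, h1]; simp

lemma bd_hh (n i : ℕ) : bd (hh n (i + 1)) = hh n i + nu (hh n i) := (bd_hh_aux n i).2

def hset (n i : ℕ) : Set (List (Fin n → ℝ)) :=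
  {l | l.length = i + 1 ∧ ∃ s : Fin n → ℝ, (∀ j, |s j| ≤ 1) ∧ (∀ j, i < j.val → s j = 0) ∧
    ∀ x ∈ l, ∑ j, s j * x j = 1 ∧ (∀ j, i < j.val → x j = 0) ∧ ∀ j, |x j| ≤ 1}

lemma ev_abs (n i : ℕ) (j : Fin n) : |ev n i j| ≤ 1 := by
  unfold ev; split_ifs <;> simp

lemma hset_neg (n i : ℕ) (l : List (Fin n → ℝ)) (h : l ∈ hset n i) : l.map Neg.neg ∈ hset n i := by
  obtain ⟨h1, s, h2, h3, h4⟩ := h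
  refine ⟨by simpa using h1, fun j => -s j, by simpa using h2, by simpa using h3, ?_⟩
  intro x hx
  obtain ⟨y, hy, rfl⟩ := List.mem_map.1 hx
  simpa using h4 y hy

lemma hh_mem (n i : ℕ) (hi : i < n) : hh n i ∈ Sup (hset n i) := by
  induction i with
  | zero =>
    refine tup_mem ⟨by simp, ev n 0, ev_abs n 0, ?_, ?_⟩
    · intro j hj; simp [ev]; omega
    · intro x hx
      obtain rfl : x = ev n 0 := by simpa using hx
      refine ⟨?_, ?_, ev_abs n 0⟩
      · rw [Finset.sum_eq_single (⟨0, hi⟩ : Fin n)]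
        · simp [ev]
        · intro b _ hb
          have : b.val ≠ 0 := fun h => hb (Fin.ext h)
          simp [ev, this]
        · simp
      · intro j hj; simp [ev]; omega
  | succ i ih =>
    have h1 := ih (by omega)
    have h2 : hh n i + nu (hh n i) ∈ Sup (hset n i) := by
      refine add_mem h1 (map_mem ?_ h1)
      intro l hl
      rw [nu_tup]; exact tup_mem (hset_neg n i l hl)
    rw [hh]
    refine map_mem ?_ h2
    rintro l ⟨h1, s, h2, h3, h4⟩
    rw [cone_tup]
    refine tup_mem ⟨by simp [h1], fun j => if j.val = i + 1 then 1 else s j, ?_, ?_, ?_⟩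
    · intro j; dsimp only; split_ifs
      · simp
      · exact h2 j
    · intro j hj
      dsimp only
      rw [if_neg (by omega)]
      exact h3 j (by omega)
    · intro x hx
      rcases List.mem_cons.1 hx with rfl | hx
      · refine ⟨?_, ?_, ev_abs n _⟩
        · rw [Finset.sum_eq_single (⟨i + 1, hi⟩ : Fin n)]
          · simp [ev]
          · intro b _ hb
            have : b.val ≠ i + 1 := fun h => hb (Fin.ext h)
            simp [ev, this]
          · simp
        · intro j hj; simp [ev]; omega
      · obtain ⟨h5, h6, h7⟩ := h4 x hx
        refine ⟨?_, fun j hj => h6 j (by omega), h7⟩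
        refine Eq.trans ?_ h5
        refine Finset.sum_congr rfl fun j _ => ?_
        dsimp only
        split_ifs with h
        · rw [h6 j (by omega)]; simp
        · rfl

lemma SdI_zero {X : Type*} [NormedAddCommGroup X] [NormedSpace ℝ X] (k j : ℕ) :
    SdI k j (0 : Ch X) = 0 := by
  induction j with
  | zero => rfl
  | succ j ih => rw [SdI_succ, ih]; simp

lemma SdI_hh_mem (n i j : ℕ) (hi : i < n) :
    SdI (i + 1) j (hh n i) ∈ Sup {l : List (Fin n → ℝ) | ∀ x ∈ l, 1 ≤ ∑ j, |x j|} := by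
  refine Sup_induction (p := fun c => SdI (i + 1) j c ∈
    Sup {l : List (Fin n → ℝ) | ∀ x ∈ l, 1 ≤ ∑ j, |x j|}) ?_ ?_ ?_ (hh_mem n i hi)
  · rw [SdI_zero]; exact zero_mem _
  · intro a b ha hb
    rw [SdI_add]; exact add_mem ha hb
  · rintro l ⟨h1, s, h2, h3, h4⟩
    have hconv : Convex ℝ {x : Fin n → ℝ | ∑ j, s j * x j = 1} := by
      intro x hx y hy a b ha hb hab
      simp only [Set.mem_ofPred_eq] at hx hy ⊢
      have : ∑ j, s j * (a • x + b • y) j = a * ∑ j, s j * x j + b * ∑ j, s j * y j := by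
        rw [Finset.mul_sum, Finset.mul_sum, ← Finset.sum_add_distrib]
        refine Finset.sum_congr rfl fun j _ => ?_
        simp; ring
      rw [this, hx, hy]; linarith
    refine Sup_mono ?_ (SdI_pres (i + 1) j _ hconv (tup_mem ⟨h1, fun x hx => (h4 x hx).1⟩))
    rintro l' ⟨-, hl'⟩ x hx
    have := hl' x hx
    simp only [Set.mem_ofPred_eq] at this
    rw [← this]
    refine Finset.sum_le_sum fun j _ => ?_
    calc s j * x j ≤ |s j * x j| := le_abs_self _
      _ = |s j| * |x j| := abs_mul _ _
      _ ≤ 1 * |x j| := by gcongr; exact h2 j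
      _ = _ := one_mul _

lemma cone_hh_mem (n i : ℕ) (hi : i < n) : cone 0 (hh n i) ∈
    Sup {l : List (Fin n → ℝ) | l.length = i + 2 ∧ ∀ x ∈ l, x ∈ Metric.closedBall 0 1} := by
  refine map_mem ?_ (hh_mem n i hi)
  rintro l ⟨h1, s, h2, h3, h4⟩
  rw [cone_tup]
  refine tup_mem ⟨by simp [h1], ?_⟩
  intro x hx
  rcases List.mem_cons.1 hx with rfl | hx
  · simp
  · rw [mem_closedBall_zero_iff, pi_norm_le_iff_of_nonneg zero_le_one]
    exact (h4 x hx).2.2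

lemma cc_change {X : Type*} (es : List (X → ZMod 2)) (l : List X) (h : cc es l ≠ 0) :
    ∀ e ∈ es, ∃ x ∈ l, ∃ y ∈ l, e x ≠ e y := by
  induction es generalizing l with
  | nil => simp
  | cons e es ih =>
    rcases l with _ | ⟨x, _ | ⟨y, l⟩⟩
    · simp [cc] at h
    · simp [cc] at h
    · simp only [cc] at h
      intro e' he'
      rcases List.mem_cons.1 he' with rfl | he'
      · refine ⟨x, by simp, y, by simp, ?_⟩
        intro hxy
        rw [hxy, two_cancel, zero_mul] at h
        exact h rfl
      · obtain ⟨a, ha, b, hb, hab⟩ := ih (y :: l) (right_ne_zero_of_mul h) e' he'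
        exact ⟨a, by simp at ha ⊢; tauto, b, by simp at hb ⊢; tauto, hab⟩

open Classical in
def eps {n : ℕ} (G : (Fin n → ℝ) → ℝ) (x : Fin n → ℝ) : ZMod 2 :=
  if 0 < G x then 1 else if G x < 0 then 0 else if WellOrderingRel x (-x) then 1 else 0

lemma eps_anti {n : ℕ} (G : (Fin n → ℝ) → ℝ) (hG : ∀ x, G (-x) = - G x) : Anti (eps G) := by
  intro x hx
  have h2 : (1 : ZMod 2) + 1 = 0 := rfl
  have hne : x ≠ -x := fun h => hx (self_eq_neg.1 h)
  unfold eps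
  rw [hG, neg_neg]
  rcases lt_trichotomy (G x) 0 with h | h | h
  · simp [h, not_lt.2 h.le]
  · rcases (trichotomous_of WellOrderingRel x (-x)).imp_right (Or.resolve_left · hne) with h3 | h3
    · rw [if_neg (by simp [h]), if_neg (by simp [h]), if_neg (asymm_of WellOrderingRel h3), if_neg (by simp [h]),
        if_neg (by simp [h]), if_pos h3, h2]
    · rw [if_neg (by simp [h]), if_neg (by simp [h]), if_pos h3, if_neg (by simp [h]),
        if_neg (by simp [h]), if_neg (asymm_of WellOrderingRel h3), zero_add]
  · simp [h, not_lt.2 h.le, h2]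

lemma eps_ne {n : ℕ} (G : (Fin n → ℝ) → ℝ) (x y : Fin n → ℝ) (h : eps G x ≠ eps G y) :
    G x * G y ≤ 0 := by
  by_contra hc
  push Not at hc
  rcases pos_and_pos_or_neg_and_neg_of_mul_pos hc with ⟨h1, h2⟩ | ⟨h1, h2⟩
  · simp [eps, h1, h2] at h
  · simp [eps, h1, h2, not_lt.2 h1.le, not_lt.2 h2.le] at h

open Classical in
def phi {X : Type*} (f : X → ℝ) (x : X) : ZMod 2 := if 0 < f x then 1 else 0

lemma phi_ne {X : Type*} (f : X → ℝ) (x y : X) (h : phi f x ≠ phi f y) :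
    f x * f y ≤ 0 := by
  unfold phi at h
  split_ifs at h with h1 h2 h2
  · exact absurd rfl h
  · push Not at h2; exact mul_nonpos_of_nonneg_of_nonpos h1.le h2
  · push Not at h1; exact mul_nonpos_of_nonpos_of_nonneg h1 h2.le
  · exact absurd rfl h

lemma bb_neg {X : Type*} [AddGroup X] (f : X → ZMod 2) (hf : ∀ x, f (-x) = f x)
    (es : List (X → ZMod 2)) (hes : ∀ e ∈ es, Anti e)
    (l : List X) (hl : (∀ x ∈ l, x ≠ 0) ∨ ∀ x ∈ l, f x = 0) :
    bb f es (l.map Neg.neg) = bb f es l := by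
  rcases l with _ | ⟨x, l⟩
  · rfl
  · simp only [List.map_cons, bb, hf]
    rcases hl with hl | hl
    · have := cc_neg es hes (x :: l) hl
      simp only [List.map_cons] at this
      rw [this]
    · rw [hl x (by simp)]; simp

lemma borsuk_approx (p : ℕ) (F : ℕ → (Fin (p + 2) → ℝ) → ℝ) (f : (Fin (p + 2) → ℝ) → ℝ)
    (hF : ∀ i x, F i (-x) = - F i x)
    (hfc : Continuous f) (hf : ∀ x, f (-x) = f x) (hf0 : f 0 < 0)
    (hf1 : ∀ x : Fin (p + 2) → ℝ, 1 ≤ ∑ j, |x j| → 0 < f x) (δ : ℝ) (hδ : 0 < δ) :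
    ∃ z ∈ Metric.closedBall (0 : Fin (p + 2) → ℝ) 1,
      (∃ x y, dist x z ≤ δ ∧ dist y z ≤ δ ∧ f x * f y ≤ 0) ∧
      ∀ i < p + 1, ∃ x y, dist x z ≤ δ ∧ dist y z ≤ δ ∧ F i x * F i y ≤ 0 := by
  obtain ⟨δ0, hδ0, hball⟩ : ∃ δ0 > 0, ∀ x, dist x 0 < δ0 → f x < 0 :=
    Metric.eventually_nhds_iff.1 (hfc.continuousAt.eventually_lt continuousAt_const hf0)
  set N := p + 3 with hN
  set r : ℝ := 1 - (N : ℝ)⁻¹ with hr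
  have hN0 : (1 : ℝ) ≤ (N : ℝ) := by rw [hN]; push_cast; linarith [Nat.cast_nonneg (α := ℝ) p]
  have hr0 : 0 ≤ r := by
    rw [hr, sub_nonneg]; exact inv_le_one_of_one_le₀ hN0
  have hr1 : r < 1 := by
    rw [hr]; have : (0 : ℝ) < (N : ℝ)⁻¹ := by positivity
    linarith
  obtain ⟨j, hj⟩ := exists_pow_lt_of_lt_one (show (0 : ℝ) < min δ δ0 / 2 by positivity) hr1
  have hj2 : r ^ j * 2 < min δ δ0 := by linarith
  set es : List ((Fin (p + 2) → ℝ) → ZMod 2) := (List.range (p + 1)).map fun i => eps (F i)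
    with hes
  have hlen : es.length = p + 1 := by simp [hes]
  have hanti : ∀ e ∈ es, Anti e := by
    intro e he
    rw [hes] at he
    obtain ⟨i, -, rfl⟩ := List.mem_map.1 he
    exact eps_anti _ (hF i)
  have hLen : ∀ i < p + 2, hh (p + 2) i ∈ Len _ (i + 1) := fun i hi =>
    Sup_mono (fun l hl => hl.1) (hh_mem (p + 2) i hi)
  set H : ℕ → Ch (Fin (p + 2) → ℝ) := fun i => SdI (i + 1) j (hh (p + 2) i) with hH
  have hHbd : ∀ i < p + 1, bd (H (i + 1)) = H i + nu (H i) := by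
    intro i hi
    simp only [hH]
    rw [bd_SdI _ _ (hLen (i + 1) (by omega)), bd_hh, SdI_add, SdI_nu]
  have hev : lext (cc es) (H (p + 1)) = 1 := by
    rw [← hlen]
    refine cc_eval H (ev (p + 2) 0) ?_ es hanti (by rwa [hlen]) ?_
    · exact SdI_single _ _
    · intro i hi
      refine Sup_mono ?_ (SdI_hh_mem (p + 2) i j (by omega))
      rintro l hl x hx rfl
      have := hl 0 hx
      simp at this
      linarith
  -- the half ball
  set C := SdI (p + 3) j (cone 0 (hh (p + 2) (p + 1))) with hC
  set D := SdI (p + 2) j (cone 0 (hh (p + 2) p)) with hD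
  have hbdC : bd C = H (p + 1) + (D + nu D) := by
    rw [hC, bd_SdI _ _ (cone_Len _ (hLen (p + 1) (by omega))), bd_cone, bd_hh, map_add,
      SdI_add, SdI_add]
    congr 2
    rw [← SdI_nu, nu_cone, neg_zero]
  have hsm : ∀ i < p + 2, SdI (i + 2) j (cone 0 (hh (p + 2) i)) ∈
      Sup {l : List (Fin (p + 2) → ℝ) | (∀ x ∈ l, x ∈ Metric.closedBall 0 1) ∧
        ∀ x ∈ l, ∀ y ∈ l, dist x y < min δ δ0} := by
    intro i hi
    have h1 := cone_hh_mem (p + 2) i hi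
    have h2 := SdI_pres (i + 2) j _ (convex_closedBall _ _) h1
    have h3 : cone 0 (hh (p + 2) i) ∈ Sup {l : List (Fin (p + 2) → ℝ) | l.length = i + 2 ∧
        ∀ x ∈ l, ∀ y ∈ l, dist x y ≤ 2} := by
      refine Sup_mono ?_ h1
      rintro l ⟨hl1, hl2⟩
      refine ⟨hl1, fun x hx y hy => ?_⟩
      have a := hl2 x hx
      have b := hl2 y hy
      rw [Metric.mem_closedBall] at a b
      linarith [dist_triangle_right x y 0]
    have h4 := SdI_small (i + 2) j N (by omega) (by omega) 2 (by norm_num) h3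
    have h5 := Submodule.mem_inf.2 ⟨h2, h4⟩
    unfold Sup at h5
    rw [← Finsupp.supported_inter] at h5
    refine Sup_mono ?_ h5
    rintro l ⟨⟨_, a⟩, _, b⟩
    exact ⟨a, fun x hx y hy => (b x hx y hy).trans_lt hj2⟩
  have hfin : lext (cc (phi f :: es)) C = 1 := by
    rw [← bb_bd, hbdC, map_add, map_add]
    have h1 : lext (bb (phi f) es) (H (p + 1)) = lext (cc es) (H (p + 1)) := by
      refine map_eq ?_ (SdI_hh_mem (p + 2) (p + 1) j (by omega))
      intro l hl
      rcases l with _ | ⟨x, l⟩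
      · simp [bb, cc_nil]
      · have : phi f x = 1 := by
          simp [phi, hf1 x (hl x (by simp))]
        simp [bb, this]
    have h2 : (lext (bb (phi f) es) ∘ₗ nu) D = lext (bb (phi f) es) D := by
      refine map_eq ?_ (hsm p (by omega))
      rintro l ⟨hl1, hl2⟩
      simp only [LinearMap.comp_apply, nu_tup, lext_tup]
      refine bb_neg _ (fun x => by simp [phi, hf]) es hanti l ?_
      by_cases h0 : (0 : Fin (p + 2) → ℝ) ∈ l
      · right
        intro x hx
        have := hball x ((hl2 x hx 0 h0).trans_le (min_le_right _ _))
        simp [phi, this.le]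
      · left
        rintro x hx rfl
        exact h0 hx
    rw [LinearMap.comp_apply] at h2
    rw [h1, hev, h2, two_cancel, add_zero]
  obtain ⟨l, ⟨hl1, hl2⟩, hl3⟩ := exists_of_ne (hsm (p + 1) (by omega))
    (f := lext (cc (phi f :: es))) (by
      have : lext (cc (phi f :: es)) C ≠ 0 := by rw [hfin]; exact one_ne_zero
      exact this)
  rw [lext_tup] at hl3
  have hch := cc_change _ l hl3
  obtain ⟨z, hz, y, hy, hzy⟩ := hch (phi f) (by simp)
  refine ⟨z, hl1 z hz, ⟨z, y, ?_, ?_, phi_ne f z y hzy⟩, ?_⟩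
  · simpa using hδ.le
  · exact (hl2 y hy z hz).le.trans (min_le_left _ _)
  · intro i hi
    obtain ⟨a, ha, b, hb, hab⟩ := hch (eps (F i)) (by
      refine List.mem_cons_of_mem _ ?_
      rw [hes]; exact List.mem_map.2 ⟨i, by simpa using hi, rfl⟩)
    exact ⟨a, b, (hl2 a ha z hz).le.trans (min_le_left _ _),
      (hl2 b hb z hz).le.trans (min_le_left _ _), eps_ne _ _ _ hab⟩

lemma limit_zero {X : Type*} [MetricSpace X] (G : X → ℝ) (hG : Continuous G) (z : ℕ → X) (w : X)
    (hz : Tendsto z atTop (nhds w)) (d : ℕ → ℝ) (hd : Tendsto d atTop (nhds 0))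
    (h : ∀ k, ∃ x y, dist x (z k) ≤ d k ∧ dist y (z k) ≤ d k ∧ G x * G y ≤ 0) : G w = 0 := by
  choose x y hx hy hxy using h
  have key : ∀ x : ℕ → X, (∀ k, dist (x k) (z k) ≤ d k) → Tendsto x atTop (nhds w) := by
    intro x hx
    have : Tendsto (fun k => dist (x k) (z k)) atTop (nhds 0) :=
      squeeze_zero (fun _ => dist_nonneg) hx hd
    exact (tendsto_iff_of_dist this).2 hz
  have h1 := ((hG.tendsto w).comp (key x hx)).mul ((hG.tendsto w).comp (key y hy))
  have h2 : G w * G w ≤ 0 := le_of_tendsto' h1 hxy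
  nlinarith [mul_self_nonneg (G w), mul_self_eq_zero.1 (le_antisymm h2 (mul_self_nonneg _))]

theorem borsuk (p : ℕ) (F : ℕ → (Fin (p + 2) → ℝ) → ℝ) (f : (Fin (p + 2) → ℝ) → ℝ)
    (hFc : ∀ i, Continuous (F i)) (hF : ∀ i x, F i (-x) = - F i x)
    (hfc : Continuous f) (hf : ∀ x, f (-x) = f x) (hf0 : f 0 < 0)
    (hf1 : ∀ x : Fin (p + 2) → ℝ, 1 ≤ ∑ j, |x j| → 0 < f x) :
    ∃ z, f z = 0 ∧ ∀ i < p + 1, F i z = 0 := by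
  choose z hz1 hz2 hz3 using fun k : ℕ => borsuk_approx p F f hF hfc hf hf0 hf1
    (1 / ((k : ℝ) + 1)) (by positivity)
  obtain ⟨w, -, φ, hφ, hw⟩ := (isCompact_closedBall (0 : Fin (p + 2) → ℝ) 1).tendsto_subseq hz1
  have hd : Tendsto (fun k : ℕ => 1 / (((φ k : ℕ) : ℝ) + 1)) atTop (nhds 0) :=
    (tendsto_one_div_add_atTop_nhds_zero_nat (𝕜 := ℝ)).comp hφ.tendsto_atTop
  refine ⟨w, limit_zero f hfc _ w hw _ hd (fun k => hz2 (φ k)), fun i hi => ?_⟩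
  exact limit_zero (F i) (hFc i) _ w hw _ hd (fun k => hz3 (φ k) i hi)

end
end SMP

namespace SMP

theorem ekeland {X : Type*} [MetricSpace X] [CompleteSpace X] (Ψ : X → ℝ)
    (hlsc : LowerSemicontinuous Ψ) (m : ℝ) (hm : ∀ x, m ≤ Ψ x) (κ : ℝ) (hκ : 0 < κ) (x0 : X) :
    ∃ x, Ψ x + κ * dist x0 x ≤ Ψ x0 ∧ ∀ y, Ψ y + κ * dist x y ≤ Ψ x → y = x := by
  set S : X → Set X := fun x => {y | Ψ y + κ * dist x y ≤ Ψ x} with hS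
  have hself : ∀ x, x ∈ S x := fun x => by simp [hS]
  have htrans : ∀ x y z, y ∈ S x → z ∈ S y → z ∈ S x := by
    intro x y z h1 h2
    simp only [hS, Set.mem_ofPred_eq] at h1 h2 ⊢
    nlinarith [dist_triangle x y z]
  have hclosed : ∀ x, IsClosed (S x) := by
    intro x
    have : LowerSemicontinuous fun y => Ψ y + κ * dist x y :=
      hlsc.add (by fun_prop : Continuous fun y => κ * dist x y).lowerSemicontinuous
    exact this.isClosed_preimage (Ψ x)
  have hstep : ∀ (x : X) (k : ℕ), ∃ y ∈ S x, ∀ z ∈ S x, Ψ y ≤ Ψ z + (1 / 2) ^ k := by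
    intro x k
    have hne : (Ψ '' S x).Nonempty := ⟨_, x, hself x, rfl⟩
    have hb : BddBelow (Ψ '' S x) := ⟨m, by rintro _ ⟨y, -, rfl⟩; exact hm y⟩
    obtain ⟨_, ⟨y, hy, rfl⟩, hlt⟩ := exists_lt_of_csInf_lt hne
      (show sInf (Ψ '' S x) < sInf (Ψ '' S x) + (1 / 2 : ℝ) ^ k from lt_add_of_pos_right _ (by positivity))
    refine ⟨y, hy, fun z hz => ?_⟩
    have := csInf_le hb ⟨z, hz, rfl⟩
    linarith
  choose g hg1 hg2 using hstep
  let x : ℕ → X := fun k => Nat.rec x0 (fun k y => g y k) k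
  have hx : ∀ k, x (k + 1) = g (x k) k := fun k => rfl
  have hmem : ∀ k l, k ≤ l → x l ∈ S (x k) := by
    intro k l hkl
    induction l, hkl using Nat.le_induction with
    | base => exact hself _
    | succ l _ ih => exact htrans _ _ _ ih (by rw [hx]; exact hg1 _ _)
  have hdist : ∀ k z, z ∈ S (x (k + 1)) → dist (x (k + 1)) z ≤ (1 / 2) ^ k / κ := by
    intro k z hz
    have h1 : z ∈ S (x k) := htrans _ _ _ (hmem k (k + 1) (by omega)) hz
    have h2 := hg2 (x k) k z h1
    rw [← hx] at h2
    simp only [hS, Set.mem_ofPred_eq] at hz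
    rw [le_div_iff₀ hκ]
    linarith
  have hlim : Tendsto (fun k : ℕ => (1 / 2 : ℝ) ^ k / κ) atTop (nhds 0) := by
    have := (tendsto_pow_atTop_nhds_zero_of_lt_one (r := (1 / 2 : ℝ)) (by norm_num) (by norm_num)).div_const κ
    simpa using this
  have hcau : CauchySeq (fun k => x (k + 1)) :=
    cauchySeq_of_le_tendsto_0' _ (fun k l hkl => hdist k _ (hmem (k + 1) (l + 1) (by omega))) hlim
  obtain ⟨w, hw⟩ := cauchySeq_tendsto_of_complete hcau
  have hwS : ∀ k, w ∈ S (x k) := by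
    intro k
    refine (hclosed (x k)).mem_of_tendsto hw ?_
    filter_upwards [eventually_ge_atTop k] with l hl
    exact hmem k (l + 1) (by omega)
  refine ⟨w, hwS 0, fun y hy => ?_⟩
  have hy' : Tendsto (fun k => x (k + 1)) atTop (nhds y) := by
    rw [tendsto_iff_dist_tendsto_zero]
    exact squeeze_zero (fun _ => dist_nonneg)
      (fun k => hdist k y (htrans _ _ _ (hwS (k + 1)) hy)) hlim
  exact tendsto_nhds_unique hy' hw

section
variable {V : Type*} [NormedAddCommGroup V] [NormedSpace ℝ V]

lemma fderiv_even (E : V → ℝ) (hE : ContDiff ℝ 1 E) (heven : ∀ u : V, E (-u) = E u) (v : V) :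
    fderiv ℝ E (-v) = - fderiv ℝ E v := by
  have h : (fun u => E (-u)) = E := funext heven
  have hd : HasFDerivAt E (fderiv ℝ E (-v)) (-v) :=
    (hE.differentiable (by norm_num)).differentiableAt.hasFDerivAt
  have h2 : HasFDerivAt (fun u => E (-u)) ((fderiv ℝ E (-v)).comp (-(ContinuousLinearMap.id ℝ V))) v :=
    HasFDerivAt.comp v hd (hasFDerivAt_id v).neg
  rw [h] at h2
  rw [h2.fderiv]
  ext x
  simp

/-- the descent field -/
lemma exists_field (E : V → ℝ) (hE : ContDiff ℝ 1 E) (heven : ∀ u : V, E (-u) = E u)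
    (η : V → V) (hη : Continuous η) (hodd : ∀ u, η (-u) = -η u) (B : Set V) (hB : IsClosed B)
    (hBs : ∀ u ∈ B, -u ∈ B) (hBpos : ∀ u ∈ B, 0 < E u) (δ : ℝ) (hδ : 0 < δ)
    (hgrad : ∀ u ∈ B, δ ≤ ‖fderiv ℝ E (η u)‖) :
    ∃ ξ : V → V, Continuous ξ ∧ (∀ u, ξ (-u) = - ξ u) ∧ (∀ u, ‖ξ u‖ ≤ 1) ∧
      (∀ u, E u ≤ 0 → ξ u = 0) ∧ ∀ u ∈ B, δ / 2 ≤ fderiv ℝ E (η u) (ξ u) := by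
  have hEc : Continuous E := hE.continuous
  have hdc : Continuous (fderiv ℝ E) := hE.continuous_fderiv one_ne_zero
  set t : V → Set V := fun u => {x | ‖x‖ ≤ 1 ∧ (E u ≤ 0 → x = 0) ∧
    (u ∈ B → δ / 2 ≤ fderiv ℝ E (η u) x)} with ht
  have hconv : ∀ u, Convex ℝ (t u) := by
    intro u x hx y hy a b ha hb hab
    obtain ⟨hx1, hx2, hx3⟩ := hx
    obtain ⟨hy1, hy2, hy3⟩ := hy
    refine ⟨?_, ?_, ?_⟩
    · have : a • x + b • y ∈ Metric.closedBall (0 : V) 1 :=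
        convex_closedBall (0 : V) 1 (by simpa using hx1) (by simpa using hy1) ha hb hab
      simpa using this
    · intro h; rw [hx2 h, hy2 h]; simp
    · intro h
      have h1 := hx3 h
      have h2 := hy3 h
      simp only [map_add, map_smul, smul_eq_mul]
      have : δ / 2 = a * (δ / 2) + b * (δ / 2) := by rw [← add_mul, hab, one_mul]
      rw [this]; gcongr
  have hloc : ∀ u, ∃ c : V, ∀ᶠ y in nhds u, c ∈ t y := by
    intro u
    by_cases hu : u ∈ B
    · obtain ⟨x, hx1, hx2⟩ : ∃ x : V, ‖x‖ ≤ 1 ∧ δ / 2 < fderiv ℝ E (η u) x := by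
        by_contra hcon
        push Not at hcon
        have h1 : ‖fderiv ℝ E (η u)‖ ≤ δ / 2 := by
          refine ContinuousLinearMap.opNorm_le_of_unit_norm (by positivity) ?_
          intro x hx
          rw [Real.norm_eq_abs, abs_le]
          have h2 := hcon x hx.le
          have h3 := hcon (-x) (by simp [hx])
          simp only [map_neg] at h3
          exact ⟨by linarith, h2⟩
        have := hgrad u hu
        linarith
      refine ⟨x, ?_⟩
      have h1 : ∀ᶠ y in nhds u, δ / 2 < fderiv ℝ E (η y) x := by
        have : Continuous fun y => fderiv ℝ E (η y) x := (hdc.comp hη).clm_apply continuous_const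
        exact (continuousAt_const.eventually_lt this.continuousAt hx2)
      have h2 : ∀ᶠ y in nhds u, 0 < E y :=
        continuousAt_const.eventually_lt hEc.continuousAt (hBpos u hu)
      filter_upwards [h1, h2] with y hy1 hy2
      exact ⟨hx1, fun h => absurd h (not_le.2 hy2), fun _ => hy1.le⟩
    · refine ⟨0, ?_⟩
      filter_upwards [hB.isOpen_compl.mem_nhds hu] with y hy
      exact ⟨by simp, fun _ => rfl, fun h => absurd h hy⟩
  obtain ⟨ξ, hξ⟩ := exists_continuous_forall_mem_convex_of_local_const hconv hloc
  refine ⟨fun u => (1 / 2 : ℝ) • (ξ u - ξ (-u)), by fun_prop, ?_, ?_, ?_, ?_⟩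
  · intro u; simp only [neg_neg, ← smul_neg, neg_sub]
  · intro u
    rw [norm_smul]
    have h1 := (hξ u).1
    have h2 := (hξ (-u)).1
    have := norm_sub_le (ξ u) (ξ (-u))
    norm_num
    linarith
  · intro u hu
    simp only
    rw [(hξ u).2.1 hu, (hξ (-u)).2.1 (by rwa [heven])]; simp
  · intro u hu
    have h1 := (hξ u).2.2 hu
    have h2 := (hξ (-u)).2.2 (hBs u hu)
    rw [hodd, fderiv_even E hE heven] at h2
    simp only [_root_.neg_apply] at h2
    simp only [map_smul, map_sub, smul_eq_mul]
    linarith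

/-- one step of descent -/
lemma one_step (E : V → ℝ) (hE : ContDiff ℝ 1 E) (η ξ : V → V) (hη : Continuous η)
    (hξ : Continuous ξ) (hξ1 : ∀ u, ‖ξ u‖ ≤ 1) (A : Set V) (hA : IsCompact A) (s τ δ : ℝ)
    (hτ : 0 < τ) (hδ : 0 < δ) (hs : ∀ u ∈ A, E (η u) ≤ s)
    (hB : ∀ u ∈ A, s - τ ≤ E (η u) → δ / 2 ≤ fderiv ℝ E (η u) (ξ u)) :
    ∃ t > 0, ∀ u ∈ A, E (η u - t • ξ u) ≤ s - t * (δ / 3) := by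
  have hEc : Continuous E := hE.continuous
  have key : ∀ᶠ t : ℝ in nhds 0, ∀ u ∈ A, 0 < t → E (η u - t • ξ u) ≤ s - t * (δ / 3) := by
    have hcont : Continuous fun z : ℝ × V => η z.2 - z.1 • ξ z.2 := by fun_prop
    have hcont1 : Continuous fun z : ℝ × V => E (η z.2 - z.1 • ξ z.2) := by fun_prop
    have hA' : ∀ u0 ∈ A, ∀ᶠ z : ℝ × V in nhds (0, u0),
        z.2 ∈ A → 0 < z.1 → E (η z.2 - z.1 • ξ z.2) ≤ s - z.1 * (δ / 3) := by
      intro u0 hu0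
      by_cases hc : s - τ ≤ E (η u0)
      · have hd := hB u0 hu0 hc
        have hst : HasStrictFDerivAt E (fderiv ℝ E (η u0)) (η u0) :=
          hE.contDiffAt.hasStrictFDerivAt one_ne_zero
        have ht : Tendsto (fun z : ℝ × V => (η z.2 - z.1 • ξ z.2, η z.2)) (nhds (0, u0))
            (nhds (η u0, η u0)) := by
          have : Continuous fun z : ℝ × V => (η z.2 - z.1 • ξ z.2, η z.2) := by fun_prop
          have := this.tendsto (0, u0)
          simpa using this
        have h1 := ht.eventually (hst.isLittleO.def (show (0 : ℝ) < δ / 12 by positivity))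
        have h2 : ∀ᶠ z : ℝ × V in nhds (0, u0), δ / 2 - δ / 12 < fderiv ℝ E (η u0) (ξ z.2) := by
          have : Continuous fun z : ℝ × V => fderiv ℝ E (η u0) (ξ z.2) := by fun_prop
          refine continuousAt_const.eventually_lt this.continuousAt ?_
          simp only
          linarith
        filter_upwards [h1, h2] with z hz1 hz2 hzA hz0
        have e : η z.2 - z.1 • ξ z.2 - η z.2 = -(z.1 • ξ z.2) := by abel
        simp only [e, map_neg, map_smul, smul_eq_mul, norm_neg, norm_smul] at hz1
        rw [Real.norm_eq_abs, Real.norm_of_nonneg hz0.le] at hz1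
        have h3 := (abs_le.1 hz1).2
        have h4 := hs z.2 hzA
        have h5 : z.1 * ‖ξ z.2‖ ≤ z.1 * 1 := mul_le_mul_of_nonneg_left (hξ1 _) hz0.le
        have h6 := mul_lt_mul_of_pos_left hz2 hz0
        nlinarith
      · push Not at hc
        have h1 : ∀ᶠ z : ℝ × V in nhds (0, u0), E (η z.2 - z.1 • ξ z.2) < s - τ := by
          refine hcont1.continuousAt.eventually_lt continuousAt_const ?_
          simpa using hc
        have h2 : ∀ᶠ z : ℝ × V in nhds (0, u0), z.1 * (δ / 3) < τ := by
          have : Continuous fun z : ℝ × V => z.1 * (δ / 3) := by fun_prop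
          refine this.continuousAt.eventually_lt continuousAt_const ?_
          simpa using hτ
        filter_upwards [h1, h2] with z hz1 hz2 hzA hz0
        linarith
    have := hA.eventually_forall_of_forall_eventually (x₀ := (0 : ℝ))
      (P := fun t u => u ∈ A → 0 < t → E (η u - t • ξ u) ≤ s - t * (δ / 3)) hA'
    filter_upwards [this] with t ht u hu
    exact ht u hu hu
  obtain ⟨r, hr, h⟩ := Metric.eventually_nhds_iff.1 key
  refine ⟨r / 2, by positivity, fun u hu => h ?_ u hu (by positivity)⟩
  rw [Real.dist_eq, sub_zero, abs_of_pos (by positivity)]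
  linarith

open BoundedContinuousFunction in
theorem deform [CompleteSpace V] (E : V → ℝ) (hE : ContDiff ℝ 1 E)
    (heven : ∀ u : V, E (-u) = E u)
    (A : Set V) (hA : IsCompact A) (hAs : ∀ u ∈ A, -u ∈ A) (c ε δ : ℝ) (hε : 0 < ε) (hεc : ε < c)
    (hδ : 0 < δ) (hεδ : 8 * ε ≤ δ * δ) (hAE : ∀ u ∈ A, E u ≤ c + ε)
    (hgrad : ∀ u ∈ A, ∀ v, dist v u ≤ δ → |E v - c| ≤ ε → δ ≤ ‖fderiv ℝ E v‖) :
    ∃ η : V → V, Continuous η ∧ (∀ u, η (-u) = -η u) ∧ (∀ u, E u ≤ 0 → η u = u) ∧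
      ∀ u ∈ A, E (η u) ≤ c - ε := by
  by_contra hcon
  push Not at hcon
  have hEc : Continuous E := hE.continuous
  have hne : A.Nonempty := by
    obtain ⟨u, hu, -⟩ := hcon id continuous_id (fun _ => rfl) (fun _ _ => rfl)
    exact ⟨u, hu⟩
  have : Nonempty A := hne.to_subtype
  set Γ : Set (V →ᵇ V) := {β | (∀ u, β (-u) = -β u) ∧ ∀ u, E u ≤ 0 → β u = 0} with hΓ
  have hΓc : IsClosed Γ := by
    have e : Γ = (⋂ u, {β : V →ᵇ V | β (-u) = -β u}) ∩
        ⋂ u, ⋂ (_ : E u ≤ 0), {β : V →ᵇ V | β u = 0} := by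
      ext β; simp [hΓ]
    have hev : ∀ u : V, Continuous fun β : V →ᵇ V => β u := fun u =>
      (BoundedContinuousFunction.lipschitz_eval_const u).continuous
    rw [e]
    refine IsClosed.inter (isClosed_iInter fun u => isClosed_eq (hev _) (hev _).neg)
      (isClosed_iInter fun u => isClosed_iInter fun _ => isClosed_eq (hev _) continuous_const)
  have : CompleteSpace Γ := hΓc.completeSpace_coe
  set Ψ : Γ → ℝ := fun β => ⨆ u : A, E ((u : V) + β.1 u) with hΨ
  have hbdd : ∀ β : Γ, BddAbove (Set.range fun u : A => E ((u : V) + β.1 u)) := by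
    intro β
    have h1 : Continuous fun u : V => E (u + β.1 u) := by
      have := β.1.continuous
      fun_prop
    have := (hA.image h1).bddAbove
    rw [Set.image_eq_range] at this
    exact this
  have hlsc : LowerSemicontinuous Ψ := by
    refine lowerSemicontinuous_ciSup hbdd fun u => Continuous.lowerSemicontinuous ?_
    have : Continuous fun β : Γ => β.1 (u : V) :=
      (BoundedContinuousFunction.lipschitz_eval_const (u : V)).continuous.comp continuous_subtype_val
    fun_prop
  have hlow : ∀ β, c - ε ≤ Ψ β := by
    intro β
    obtain ⟨u, hu, h⟩ := hcon (fun u => u + β.1 u) (by have := β.1.continuous; fun_prop)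
      (fun u => by rw [β.2.1 u]; abel) (fun u hu => by rw [β.2.2 u hu, add_zero])
    exact h.le.trans (le_ciSup (hbdd β) ⟨u, hu⟩)
  have hlow' : ∀ β, c - ε < Ψ β := by
    intro β
    obtain ⟨u, hu, h⟩ := hcon (fun u => u + β.1 u) (by have := β.1.continuous; fun_prop)
      (fun u => by rw [β.2.1 u]; abel) (fun u hu => by rw [β.2.2 u hu, add_zero])
    exact h.trans_le (le_ciSup (hbdd β) ⟨u, hu⟩)
  have hzero : (0 : V →ᵇ V) ∈ Γ := by simp [hΓ]
  obtain ⟨β, hβ1, hβ2⟩ := ekeland Ψ hlsc (c - ε) hlow (δ / 4) (by positivity) ⟨0, hzero⟩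
  have h0 : Ψ ⟨0, hzero⟩ ≤ c + ε := by
    refine ciSup_le fun u => ?_
    simpa using hAE u u.2
  set s := Ψ β with hs
  have hsl := hlow' β
  have hdist : dist (⟨0, hzero⟩ : Γ) β ≤ δ := by
    by_contra hd
    push Not at hd
    nlinarith
  have hnorm : ‖β.1‖ ≤ δ := by
    have e : dist (⟨0, hzero⟩ : Γ) β = ‖β.1‖ := by
      rw [Subtype.dist_eq, dist_zero_left]
    rwa [e] at hdist
  have hss : s ≤ c + ε := by
    have : 0 ≤ δ / 4 * dist (⟨0, hzero⟩ : Γ) β := by positivity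
    linarith
  set η : V → V := fun u => u + β.1 u with hη
  have hηc : Continuous η := by have := β.1.continuous; fun_prop
  have hηodd : ∀ u, η (-u) = -η u := fun u => by simp only [hη]; rw [β.2.1 u]; abel
  set τ := s - (c - ε) with hτ
  have hτ0 : 0 < τ := by linarith
  set B : Set V := {u ∈ A | s - τ ≤ E (η u)} with hB
  have hBc : IsClosed B := hA.isClosed.inter (isClosed_le continuous_const (hE.continuous.comp hηc))
  have hsup : ∀ u ∈ A, E (η u) ≤ s := fun u hu => le_ciSup (hbdd β) ⟨u, hu⟩
  obtain ⟨ξ, hξc, hξodd, hξ1, hξ0, hξB⟩ := exists_field E hE heven η hηc hηodd B hBc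
    (fun u hu => ⟨hAs u hu.1, by rw [hηodd, heven]; exact hu.2⟩)
    (fun u hu => by
      by_contra hn
      push Not at hn
      have h1 := hu.2
      simp only [hη, β.2.2 u hn, add_zero] at h1
      linarith) δ hδ
    (fun u hu => by
      refine hgrad u hu.1 _ ?_ ?_
      · rw [dist_eq_norm]
        simp only [hη, add_sub_cancel_left]
        exact (β.1.norm_coe_le_norm u).trans hnorm
      · have h1 := hu.2
        have h2 := hsup u hu.1
        rw [abs_le]; constructor <;> linarith)
  obtain ⟨t, ht, hstep⟩ := one_step E hE η ξ hηc hξc hξ1 A hA s τ δ hτ0 hδ hsup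
    (fun u hu h => hξB u ⟨hu, h⟩)
  set ζ : V →ᵇ V := BoundedContinuousFunction.ofNormedAddCommGroup ξ hξc 1 hξ1 with hζ
  have hζ1 : ‖ζ‖ ≤ 1 := BoundedContinuousFunction.norm_ofNormedAddCommGroup_le _ zero_le_one hξ1
  have hmem : β.1 - t • ζ ∈ Γ := by
    refine ⟨fun u => ?_, fun u hu => ?_⟩
    · have : ζ (-u) = - ζ u := hξodd u
      simp only [BoundedContinuousFunction.coe_sub, BoundedContinuousFunction.coe_smul,
        Pi.sub_apply, β.2.1 u, this, smul_neg]
      abel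
    · have : ζ u = 0 := hξ0 u hu
      simp only [BoundedContinuousFunction.coe_sub, BoundedContinuousFunction.coe_smul,
        Pi.sub_apply, β.2.2 u hu, this, smul_zero, sub_zero]
  have hΨ' : Ψ ⟨β.1 - t • ζ, hmem⟩ ≤ s - t * (δ / 3) := by
    refine ciSup_le fun u => ?_
    have h1 := hstep u u.2
    have h2 : (u : V) + (β.1 - t • ζ) (u : V) = η u - t • ξ u := (add_sub_assoc _ _ _).symm
    change E ((u : V) + (β.1 - t • ζ) (u : V)) ≤ _
    rw [h2]
    exact h1
  have hd : dist β ⟨β.1 - t • ζ, hmem⟩ ≤ t := by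
    rw [Subtype.dist_eq, dist_eq_norm]
    simp only [sub_sub_cancel, norm_smul, Real.norm_of_nonneg ht.le]
    nlinarith
  have heq := hβ2 ⟨β.1 - t • ζ, hmem⟩ (by nlinarith)
  rw [heq] at hΨ'
  have : 0 < t * (δ / 3) := by positivity
  linarith

end
end SMP

namespace SMP
section
variable {V : Type*} [NormedAddCommGroup V] [NormedSpace ℝ V]

/-- the set `A` can be separated with `q` odd functions -/
def QQ (E : V → ℝ) (ρ : ℝ) (A : Set V) (q : ℕ) : Prop :=
  ∃ (F : ℕ → V → ℝ) (f : V → ℝ), (∀ i, Continuous (F i)) ∧ (∀ i u, F i (-u) = -F i u) ∧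
    Continuous f ∧ (∀ u, f (-u) = f u) ∧ (∀ u, E u ≤ 0 → f u = ‖u‖ - ρ) ∧
    ∀ u ∈ A, (∀ i < q, F i u = 0) → f u ≠ 0

/-- all compact symmetric subsets of the sublevel `c` can be separated -/
def TT (E : V → ℝ) (ρ c : ℝ) (q : ℕ) : Prop :=
  ∀ A : Set V, IsCompact A → (∀ u ∈ A, -u ∈ A) → (∀ u ∈ A, E u ≤ c) → QQ E ρ A q

lemma TT_anti {E : V → ℝ} {ρ c c' : ℝ} {q : ℕ} (h : TT E ρ c q) (hc : c' ≤ c) : TT E ρ c' q :=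
  fun A h1 h2 h3 => h A h1 h2 fun u hu => (h3 u hu).trans hc

lemma base_case [CompleteSpace V] (E : V → ℝ) (Vm Vp : Submodule ℝ V)
    (hVmc : IsClosed (Vm : Set V)) (hVpc : IsClosed (Vp : Set V))
    (hfd : FiniteDimensional ℝ Vm) (hcompl : IsCompl Vm Vp)
    (ρ α : ℝ) (hα : 0 < α) (hsphere : ∀ u ∈ Vp, ‖u‖ = ρ → α ≤ E u) :
    TT E ρ (α / 2) (Module.finrank ℝ Vm) := by
  intro A _ _ hA
  let P := Vm.linearProjOfClosedCompl Vp hcompl hVmc hVpc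
  let b := Module.finBasis ℝ Vm
  let L : Fin (Module.finrank ℝ Vm) → V →ₗ[ℝ] ℝ := fun i => (b.coord i).comp (P : V →ₗ[ℝ] Vm)
  have hL : ∀ i, Continuous (L i) := fun i =>
    ((b.coord i).continuous_of_finiteDimensional).comp P.continuous
  refine ⟨fun i => if h : i < Module.finrank ℝ Vm then L ⟨i, h⟩ else fun _ => 0,
    fun u => ‖u‖ - ρ, ?_, ?_, ?_, ?_, fun u _ => rfl, ?_⟩
  · intro i
    by_cases h : i < Module.finrank ℝ Vm
    · simpa [h] using hL ⟨i, h⟩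
    · simpa [h] using continuous_const
  · intro i u
    by_cases h : i < Module.finrank ℝ Vm
    · simp [h]
    · simp [h]
  · fun_prop
  · intro u; simp
  · intro u hu h0 hf
    have h1 : P u = 0 := by
      apply b.ext_elem
      intro i
      have := h0 i i.2
      simp only [i.2, dite_true] at this
      simpa [L] using this
    have h2 : u ∈ Vp := by
      rw [← Submodule.ker_projectionOnto hcompl]
      exact h1
    have := hsphere u h2 (by linarith)
    have := hA u hu
    linarith

lemma ps_lemma (E : V → ℝ) (hE : ContDiff ℝ 1 E)
    (hPS : ∀ u : ℕ → V,
      (∃ C : ℝ, ∀ m, |E (u m)| ≤ C) →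
      Tendsto (fun m => ‖fderiv ℝ E (u m)‖) atTop (nhds 0) →
      ∃ (k : ℕ → ℕ) (v : V), StrictMono k ∧ Tendsto (u ∘ k) atTop (nhds v))
    (c : ℝ) (N : Set V) (hN : IsOpen N) (hK : ∀ u, E u = c → fderiv ℝ E u = 0 → u ∈ N) :
    ∃ δ > 0, ∀ u ∉ N, ∀ v, dist v u ≤ δ → |E v - c| ≤ δ → δ ≤ ‖fderiv ℝ E v‖ := by
  by_contra hcon
  push Not at hcon
  have hpos : ∀ k : ℕ, (0 : ℝ) < 1 / ((k : ℝ) + 1) := fun k => by positivity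
  choose u hu v hd hEv hg using fun k : ℕ => hcon (1 / ((k : ℝ) + 1)) (hpos k)
  have hlim : Tendsto (fun k : ℕ => 1 / ((k : ℝ) + 1)) atTop (nhds 0) :=
    tendsto_one_div_add_atTop_nhds_zero_nat
  have hE0 : Tendsto (fun k => E (v k) - c) atTop (nhds 0) := by
    rw [tendsto_zero_iff_abs_tendsto_zero]
    exact squeeze_zero (fun _ => abs_nonneg _) hEv hlim
  have hEl : Tendsto (fun k => E (v k)) atTop (nhds c) := by
    simpa using hE0.add_const c
  have hgl : Tendsto (fun m => ‖fderiv ℝ E (v m)‖) atTop (nhds 0) :=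
    squeeze_zero (fun _ => norm_nonneg _) (fun k => (hg k).le) hlim
  obtain ⟨k, w, hk, hw⟩ := hPS v ⟨|c| + 1, fun m => by
    have h1 := hEv m
    have h2 : 1 / ((m : ℝ) + 1) ≤ 1 := by
      rw [div_le_one (by positivity)]; linarith [(Nat.cast_nonneg m : (0 : ℝ) ≤ m)]
    have h3 := abs_add_le (E (v m) - c) c
    rw [sub_add_cancel] at h3
    linarith⟩ hgl
  have hEw : E w = c :=
    tendsto_nhds_unique ((hE.continuous.tendsto w).comp hw) (hEl.comp hk.tendsto_atTop)
  have hfc : Continuous (fun x => ‖fderiv ℝ E x‖) := (hE.continuous_fderiv (by norm_num)).norm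
  have hDw : ‖fderiv ℝ E w‖ = 0 :=
    tendsto_nhds_unique ((hfc.tendsto w).comp hw) (hgl.comp hk.tendsto_atTop)
  have hdl : Tendsto (fun n => dist (v (k n)) (u (k n))) atTop (nhds 0) :=
    squeeze_zero (fun _ => dist_nonneg) (fun n => hd (k n)) (hlim.comp hk.tendsto_atTop)
  have hul : Tendsto (fun n => u (k n)) atTop (nhds w) :=
    (tendsto_iff_of_dist hdl).1 hw
  have : w ∈ Nᶜ := hN.isClosed_compl.mem_of_tendsto hul (Eventually.of_forall fun n => hu (k n))
  exact this (hK w hEw (norm_eq_zero.1 hDw))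

lemma sep_lemma (E : V → ℝ) (hE : ContDiff ℝ 1 E)
    (hPS : ∀ u : ℕ → V,
      (∃ C : ℝ, ∀ m, |E (u m)| ≤ C) →
      Tendsto (fun m => ‖fderiv ℝ E (u m)‖) atTop (nhds 0) →
      ∃ (k : ℕ → ℕ) (v : V), StrictMono k ∧ Tendsto (u ∘ k) atTop (nhds v))
    (hE0 : E 0 = 0) (c : ℝ) (hc : 0 < c) :
    ∃ (r : ℕ) (l : ℕ → V →L[ℝ] ℝ), ((∀ u, E u = c → fderiv ℝ E u ≠ 0) → r = 0) ∧
      ∀ u, E u = c → fderiv ℝ E u = 0 → ∃ i < r, l i u ≠ 0 := by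
  by_cases hemp : ∀ u, E u = c → fderiv ℝ E u ≠ 0
  · exact ⟨0, fun _ => 0, fun _ => rfl, fun u h1 h2 => absurd h2 (hemp u h1)⟩
  set K : Set V := {u | E u = c ∧ fderiv ℝ E u = 0} with hK
  have hKc : IsCompact K := by
    apply IsSeqCompact.isCompact
    intro u hu
    obtain ⟨k, w, hk, hw⟩ := hPS u ⟨|c|, fun m => by rw [(hu m).1]⟩ (by
      have : (fun m => ‖fderiv ℝ E (u m)‖) = fun _ => 0 := by
        funext m; rw [(hu m).2, norm_zero]
      rw [this]; exact tendsto_const_nhds)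
    have hcl : IsClosed K := (isClosed_eq hE.continuous continuous_const).inter
      (isClosed_eq (hE.continuous_fderiv (by norm_num)) continuous_const)
    exact ⟨w, hcl.mem_of_tendsto hw (Eventually.of_forall fun n => hu (k n)), k, hk, hw⟩
  obtain ⟨t, ht⟩ := hKc.elim_finite_subcover (fun l : V →L[ℝ] ℝ => {u | l u ≠ 0})
    (fun l => isOpen_ne_fun l.continuous continuous_const) (by
      intro u hu
      have hne : u ≠ 0 := by
        rintro rfl
        have := hu.1
        linarith
      obtain ⟨l, hl⟩ := SeparatingDual.exists_ne_zero (R := ℝ) hne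
      exact Set.mem_iUnion.2 ⟨l, hl⟩)
  refine ⟨t.toList.length, fun i => t.toList.getD i 0, fun h => absurd h hemp, fun u h1 h2 => ?_⟩
  have := ht ⟨h1, h2⟩
  simp only [Set.mem_iUnion] at this
  obtain ⟨l, hl, hlu⟩ := this
  obtain ⟨i, hi, rfl⟩ := List.getElem_of_mem (Finset.mem_toList.2 hl)
  refine ⟨i, hi, ?_⟩
  beta_reduce
  rw [List.getD_eq_getElem _ _ hi]
  exact hlu

lemma step_lemma [CompleteSpace V] (E : V → ℝ) (hE : ContDiff ℝ 1 E)
    (hPS : ∀ u : ℕ → V,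
      (∃ C : ℝ, ∀ m, |E (u m)| ≤ C) →
      Tendsto (fun m => ‖fderiv ℝ E (u m)‖) atTop (nhds 0) →
      ∃ (k : ℕ → ℕ) (v : V), StrictMono k ∧ Tendsto (u ∘ k) atTop (nhds v))
    (heven : ∀ u : V, E (-u) = E u) (hE0 : E 0 = 0) (ρ c : ℝ) (hc : 0 < c) :
    ∃ ε > 0, ∃ r : ℕ, ((∀ u, E u = c → fderiv ℝ E u ≠ 0) → r = 0) ∧
      ∀ q, TT E ρ (c - ε) q → TT E ρ (c + ε) (q + r) := by
  obtain ⟨r, l, hr, hl⟩ := sep_lemma E hE hPS hE0 c hc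
  have hNo : IsOpen {u : V | ∃ i < r, l i u ≠ 0} := by
    have : {u : V | ∃ i < r, l i u ≠ 0} = ⋃ i, ⋃ (_ : i < r), {u | l i u ≠ 0} := by
      ext u; simp
    rw [this]
    exact isOpen_iUnion fun i => isOpen_iUnion fun _ =>
      isOpen_ne_fun (l i).continuous continuous_const
  obtain ⟨δ, hδ, hgrad⟩ := ps_lemma E hE hPS c _ hNo hl
  have e1 : 0 < min δ (min (δ * δ / 8) (c / 2)) := by positivity
  have e2 : min δ (min (δ * δ / 8) (c / 2)) ≤ δ := min_le_left _ _
  have e3 : min δ (min (δ * δ / 8) (c / 2)) ≤ δ * δ / 8 := (min_le_right _ _).trans (min_le_left _ _)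
  have e4 : min δ (min (δ * δ / 8) (c / 2)) ≤ c / 2 := (min_le_right _ _).trans (min_le_right _ _)
  generalize min δ (min (δ * δ / 8) (c / 2)) = ε at e1 e2 e3 e4
  refine ⟨ε, e1, r, hr, fun q hT A hA hAs hAE => ?_⟩
  set A₁ : Set V := {u ∈ A | ∀ i < r, l i u = 0} with hA₁
  have hcl : IsClosed {u : V | ∀ i < r, l i u = 0} := by
    have : {u : V | ∀ i < r, l i u = 0} = {u : V | ∃ i < r, l i u ≠ 0}ᶜ := by
      ext u; simp
    rw [this]; exact hNo.isClosed_compl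
  have hA₁c : IsCompact A₁ := hA.inter_right hcl
  have hA₁s : ∀ u ∈ A₁, -u ∈ A₁ := fun u hu =>
    ⟨hAs u hu.1, fun i hi => by rw [map_neg, hu.2 i hi, neg_zero]⟩
  obtain ⟨η, hηc, hηodd, hη0, hηA⟩ := deform E hE heven A₁ hA₁c hA₁s c ε δ e1 (by linarith) hδ
    (by linarith) (fun u hu => hAE u hu.1) (fun u hu v hv hEv =>
      hgrad u (by rintro ⟨i, hi, h⟩; exact h (hu.2 i hi)) v hv (hEv.trans e2))
  obtain ⟨F, f, hFc, hFo, hfc, hfe, hf0, hfA⟩ := hT (η '' A₁) (hA₁c.image hηc)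
    (by rintro _ ⟨u, hu, rfl⟩; exact ⟨-u, hA₁s u hu, hηodd u⟩)
    (by rintro _ ⟨u, hu, rfl⟩; exact hηA u hu)
  refine ⟨fun i u => if i < r then l i u else F (i - r) (η u), fun u => f (η u),
    fun i => ?_, fun i u => ?_, hfc.comp hηc, fun u => ?_, fun u hu => ?_, fun u hu h0 => ?_⟩
  · by_cases h : i < r
    · simpa [h] using (l i).continuous
    · simp only [h, if_false]
      exact (hFc (i - r)).comp hηc
  · by_cases h : i < r
    · simp [h]
    · simp [h, hηodd, hFo]
  · simp only [hηodd, hfe]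
  · simp only [hη0 u hu, hf0 u hu]
  · have hu1 : u ∈ A₁ := ⟨hu, fun i hi => by
      have := h0 i (by omega)
      simpa [hi] using this⟩
    refine hfA (η u) ⟨u, hu1, rfl⟩ fun i hi => ?_
    have := h0 (i + r) (by omega)
    simpa using this

lemma sup_arg (S : Set ℝ) (a : ℝ) (ha : a ∈ S) (hdown : ∀ c ∈ S, ∀ c' ≤ c, c' ∈ S)
    (hstep : ∀ c ≥ a, ∃ ε > 0, c - ε ∈ S → c + ε ∈ S) (c : ℝ) : c ∈ S := by
  by_contra hc
  have hb : BddAbove S := ⟨c, fun x hx => by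
    by_contra h
    exact hc (hdown x hx c (by linarith))⟩
  obtain ⟨ε, hε, h⟩ := hstep (sSup S) (le_csSup hb ha)
  obtain ⟨x, hx, hlt⟩ := exists_lt_of_lt_csSup ⟨a, ha⟩ (show sSup S - ε < sSup S by linarith)
  have := le_csSup hb (h (hdown x hx _ hlt.le))
  linarith

lemma final_contra (hinf : ¬ FiniteDimensional ℝ V)
    (E : V → ℝ) (hEc : Continuous E) (heven : ∀ u : V, E (-u) = E u) (hE0 : E 0 = 0)
    (ρ : ℝ) (hρ : 0 < ρ)
    (hfin : ∀ W : Submodule ℝ V, FiniteDimensional ℝ W →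
      ∃ R > 0, ∀ u ∈ W, R ≤ ‖u‖ → E u ≤ 0) (q : ℕ) (hT : ∀ c, TT E ρ c q) : False := by
  let b := Module.Basis.ofVectorSpace ℝ V
  have hIinf : Infinite (Module.Basis.ofVectorSpaceIndex ℝ V) := by
    by_contra h
    rw [not_infinite_iff_finite] at h
    exact hinf (Module.Finite.of_basis b)
  let em := Infinite.natEmbedding (Module.Basis.ofVectorSpaceIndex ℝ V)
  let e : Fin (q + 2) → V := fun j => b (em j)
  have hli : LinearIndependent ℝ e :=
    b.linearIndependent.comp (fun j : Fin (q + 2) => em j)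
      (em.injective.comp Fin.val_injective)
  let Φ : (Fin (q + 2) → ℝ) →ₗ[ℝ] V := Fintype.linearCombination ℝ e
  have hker : LinearMap.ker Φ = ⊥ := by
    rw [LinearMap.ker_eq_bot]
    exact hli.fintypeLinearCombination_injective
  have hΦc : Continuous Φ := Φ.continuous_of_finiteDimensional
  obtain ⟨K, hK, hanti⟩ := Φ.exists_antilipschitzWith hker
  have hKb : ∀ x, ‖x‖ ≤ K * ‖Φ x‖ := fun x => by
    have := hanti.le_mul_dist x 0
    simpa using this
  obtain ⟨R₀, hR₀, hR₀E⟩ := hfin (LinearMap.range Φ) inferInstance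
  have hR1 : R₀ ≤ max R₀ (ρ + 1) := le_max_left _ _
  have hR2 : ρ + 1 ≤ max R₀ (ρ + 1) := le_max_right _ _
  generalize max R₀ (ρ + 1) = R at hR1 hR2
  have hRpos : 0 < R := by linarith
  have hKpos : (0 : ℝ) < K := hK
  set lam : ℝ := ((q : ℝ) + 2) * K * R with hlam
  have hlampos : 0 < lam := by positivity
  have hbig : ∀ x : Fin (q + 2) → ℝ, 1 ≤ ∑ j, |x j| → R ≤ ‖Φ (lam • x)‖ := by
    intro x hx
    have h1 : ∑ j, |x j| ≤ ((q : ℝ) + 2) * ‖x‖ := by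
      have : ∑ j, |x j| ≤ ∑ _j : Fin (q + 2), ‖x‖ :=
        Finset.sum_le_sum fun j _ => norm_le_pi_norm x j
      simpa using this
    have h2 := hKb x
    rw [map_smul, norm_smul, Real.norm_of_nonneg hlampos.le, hlam]
    have h3 : 1 ≤ ((q : ℝ) + 2) * (K * ‖Φ x‖) :=
      (hx.trans h1).trans (mul_le_mul_of_nonneg_left h2 (by positivity))
    nlinarith
  let Ψ : (Fin (q + 2) → ℝ) → V := fun x => Φ (lam • x)
  have hΨc : Continuous Ψ := hΦc.comp (continuous_const_smul lam)
  have hΨo : ∀ x, Ψ (-x) = -Ψ x := fun x => by simp [Ψ]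
  set A := Ψ '' Metric.closedBall 0 1 with hA
  have hAc : IsCompact A := (isCompact_closedBall _ _).image hΨc
  obtain ⟨c, hc⟩ := (hAc.image hEc).bddAbove
  obtain ⟨F, f, hFc, hFo, hfc, hfe, hf0, hfA⟩ := hT c A hAc
    (by
      rintro _ ⟨x, hx, rfl⟩
      exact ⟨-x, by simpa using hx, hΨo x⟩)
    (fun u hu => hc ⟨u, hu, rfl⟩)
  have hpos : ∀ x : Fin (q + 2) → ℝ, 1 ≤ ∑ j, |x j| → 0 < f (Ψ x) := by
    intro x hx
    have h1 := hbig x hx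
    rw [hf0 (Ψ x) (hR₀E _ ⟨_, rfl⟩ (hR1.trans h1))]
    have : R ≤ ‖Ψ x‖ := h1
    linarith
  obtain ⟨z, hz, hzF⟩ := borsuk q (fun i x => F i (Ψ x)) (fun x => f (Ψ x))
    (fun i => (hFc i).comp hΨc) (fun i x => by simp only [hΨo, hFo]) (hfc.comp hΨc)
    (fun x => by simp only [hΨo, hfe])
    (by
      have : Ψ 0 = 0 := by simp [Ψ]
      simp only [this]
      rw [hf0 0 hE0.le]
      simpa using hρ) hpos
  have hzs : ∑ j, |z j| < 1 := by
    by_contra h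
    push Not at h
    have := hpos z h
    linarith
  refine hfA (Ψ z) ⟨z, ?_, rfl⟩ (fun i hi => hzF i (by omega)) hz
  rw [mem_closedBall_zero_iff, pi_norm_le_iff_of_nonneg zero_le_one]
  intro j
  exact (Finset.single_le_sum (f := fun j => |z j|) (fun _ _ => abs_nonneg _)
    (Finset.mem_univ j)).trans hzs.le

end
end SMP

/-- Symmetric Mountain Pass Theorem (Proposition 2.12 of the paper; Rabinowitz,
Theorem 9.12). Let `V` be an infinite-dimensional real Banach space, `E` a `C¹` even
functional with `E(0) = 0` satisfying the Palais–Smale condition, and `V = V⁻ ⊕ V⁺`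
with `V⁻` finite-dimensional. If `E ≥ α > 0` on the sphere of radius `ρ > 0` in `V⁺`,
and on every finite-dimensional subspace `W` the functional `E` is `≤ 0` outside a ball
of radius `R(W)`, then `E` has an unbounded sequence of critical values. -/
theorem stmt_5 {V : Type*} [NormedAddCommGroup V] [NormedSpace ℝ V] [CompleteSpace V]
    (hinf : ¬ FiniteDimensional ℝ V)
    (E : V → ℝ) (hE : ContDiff ℝ 1 E)
    (hPS : ∀ u : ℕ → V,
      (∃ C : ℝ, ∀ m, |E (u m)| ≤ C) →
      Tendsto (fun m => ‖fderiv ℝ E (u m)‖) atTop (nhds 0) →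
      ∃ (k : ℕ → ℕ) (v : V), StrictMono k ∧ Tendsto (u ∘ k) atTop (nhds v))
    (heven : ∀ u : V, E (-u) = E u) (hE0 : E 0 = 0)
    (Vm Vp : Submodule ℝ V)
    (hVmc : IsClosed (Vm : Set V)) (hVpc : IsClosed (Vp : Set V))
    (hfd : FiniteDimensional ℝ Vm) (hcompl : IsCompl Vm Vp)
    (ρ α : ℝ) (hρ : 0 < ρ) (hα : 0 < α)
    (hsphere : ∀ u ∈ Vp, ‖u‖ = ρ → α ≤ E u)
    (hfin : ∀ W : Submodule ℝ V, FiniteDimensional ℝ W →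
      ∃ R > 0, ∀ u ∈ W, R ≤ ‖u‖ → E u ≤ 0) :
    ∃ u : ℕ → V, (∀ k, fderiv ℝ E (u k) = 0) ∧
      Tendsto (fun k => E (u k)) atTop atTop := by
  have hall : ∀ c : ℝ, c ∈ {c | ∃ q, SMP.TT E ρ c q} := by
    refine SMP.sup_arg _ (α / 2)
      ⟨_, SMP.base_case E Vm Vp hVmc hVpc hfd hcompl ρ α hα hsphere⟩
      (fun c ⟨q, hq⟩ c' hc' => ⟨q, SMP.TT_anti hq hc'⟩) fun c hc => ?_
    obtain ⟨ε, hε, r, _, h⟩ := SMP.step_lemma E hE hPS heven hE0 ρ c (by linarith)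
    exact ⟨ε, hε, fun ⟨q, hq⟩ => ⟨q + r, h q hq⟩⟩
  have hunb : ∀ n : ℕ, ∃ u, fderiv ℝ E u = 0 ∧ (n : ℝ) ≤ E u := by
    intro n
    by_contra hcon
    push Not at hcon
    obtain ⟨q, hq⟩ := hall ((n : ℝ) + 1)
    refine SMP.final_contra hinf E hE.continuous heven hE0 ρ hρ hfin q fun c => ?_
    refine SMP.sup_arg {c | SMP.TT E ρ c q} ((n : ℝ) + 1) hq
      (fun c h c' hc' => SMP.TT_anti h hc') (fun c hc => ?_) c
    obtain ⟨ε, hε, r, hr, h⟩ := SMP.step_lemma E hE hPS heven hE0 ρ c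
      (by have : (0 : ℝ) ≤ n := Nat.cast_nonneg n
          linarith)
    have hr0 : r = 0 := hr fun u hu h0 => by
      have := hcon u h0
      linarith
    subst hr0
    exact ⟨ε, hε, fun hh => h q hh⟩
  choose u hu1 hu2 using hunb
  exact ⟨u, hu1, tendsto_atTop_mono hu2 tendsto_natCast_atTop_atTop⟩
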